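/- arXiv:2108.01302 — 2 statements merged into one kernel-verified Lean document; each statement's English description precedes it below -/
import Mathlib

section
/- Let G be an abelian group and B ⊆ G a set containing a Bohr neighborhood of 0, and let c ∈ ℤ be such that the subgroup cG = {c·g : g ∈ G} has finite index in G. Then the set cB := {c·b : b ∈ B} also contains a Bohr neighborhood of 0 in G. -/
/-- `S` contains a Bohr neighborhood of `0`. -/
def ContainsBohrNhd {G : Type*} [AddCommGroup G] (S : Set G) : Prop :=
  ∃ (k : ℕ) (χ : Fin k → AddChar G ℂ) (ε : ℝ), 0 < ε ∧ (∀ i g, ‖χ i g‖ = 1) ∧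
    ∀ g : G, (∀ i, ‖χ i g - 1‖ < ε) → g ∈ S

/-- The subgroup `cG = {c • g : g ∈ G}`. -/
def multiplesSubgroup (G : Type*) [AddCommGroup G] (c : ℤ) : AddSubgroup G :=
  AddMonoidHom.range (AddMonoidHom.mk' (fun g : G => c • g) (fun a b => smul_add c a b))

open Filter Topology

/-- A character of `G` factors through `f : G →+ H` as soon as it is trivial on the kernel of `f`. -/
theorem exists_character_comp_eq {G H : Type*} [AddCommGroup G] [AddCommGroup H] (f : G →+ H)
    (χ : G →+ UnitAddCircle) (h : ∀ g, f g = 0 → χ g = 0) :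
    ∃ ψ : H →+ UnitAddCircle, ∀ g, ψ (f g) = χ g := by
  obtain ⟨ψ, hψ⟩ := (Module.Baer.of_divisible UnitAddCircle).extension_property_addMonoidHom
    (QuotientAddGroup.kerLift f) (QuotientAddGroup.kerLift_injective f)
    (QuotientAddGroup.lift f.ker χ h)
  exact ⟨ψ, fun g => DFunLike.congr_fun hψ (g : G ⧸ f.ker)⟩

theorem exists_character_ne_zero {A : Type*} [AddCommGroup A] {a : A} (ha : a ≠ 0) :
    ∃ φ : A →+ UnitAddCircle, φ a ≠ 0 := by
  obtain ⟨t, ht0, ht⟩ : ∃ t : UnitAddCircle, t ≠ 0 ∧ addOrderOf a • t = 0 := by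
    have key : ∀ n : ℕ, 2 ≤ n → ∃ t : UnitAddCircle, t ≠ 0 ∧ n • t = 0 := by
      intro n hn
      have ho := AddCircle.addOrderOf_period_div (p := (1 : ℝ)) (n := n) (by omega)
      refine ⟨_, fun h => ?_, addOrderOf_dvd_iff_nsmul_eq_zero.1 ho.dvd⟩
      rw [h, addOrderOf_zero] at ho
      omega
    obtain h | h := Nat.eq_zero_or_pos (addOrderOf a)
    · obtain ⟨t, ht, -⟩ := key 2 le_rfl
      exact ⟨t, ht, by rw [h, zero_smul]⟩
    · have : addOrderOf a ≠ 1 := fun h => ha (AddMonoid.addOrderOf_eq_one_iff.1 h)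
      exact key _ (by omega)
  obtain ⟨ψ, hψ⟩ := exists_character_comp_eq (zmultiplesHom A a) (zmultiplesHom _ t) (by
    intro n hn
    obtain ⟨m, rfl⟩ := addOrderOf_dvd_iff_zsmul_eq_zero.2 (by simpa using hn)
    simp [mul_comm _ m, mul_smul, ht])
  refine ⟨ψ, ?_⟩
  have := hψ 1
  simp only [zmultiplesHom_apply, one_smul] at this
  rwa [this]

theorem exists_character_ne_zero_of_notMem {A : Type*} [AddCommGroup A] {H : AddSubgroup A} {a : A}
    (ha : a ∉ H) : ∃ φ : A →+ UnitAddCircle, (∀ h ∈ H, φ h = 0) ∧ φ a ≠ 0 := by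
  obtain ⟨φ, hφ⟩ := exists_character_ne_zero (A := A ⧸ H) (a := (a : A ⧸ H))
    (by rwa [Ne, QuotientAddGroup.eq_zero_iff])
  refine ⟨φ.comp (QuotientAddGroup.mk' H), fun h hh => ?_, hφ⟩
  simp [(QuotientAddGroup.eq_zero_iff h).2 hh]

/-- On the `c`-torsion of the circle, every homomorphism is multiplication by an integer. -/
theorem exists_eq_zsmul_of_zsmul_eq_zero {c : ℤ} (hc : c ≠ 0) (φ : UnitAddCircle →+ UnitAddCircle) :
    ∃ m : ℤ, ∀ u, c • u = 0 → φ u = m • u := by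
  have hn : 0 < c.natAbs := Int.natAbs_pos.2 hc
  have torsion : ∀ u : UnitAddCircle, c.natAbs • u = 0 →
      ∃ k : ℕ, u = k • (((1 / c.natAbs : ℝ)) : UnitAddCircle) := by
    intro u hu
    obtain ⟨k, -, rfl⟩ := (AddCircle.nsmul_eq_zero_iff hn).1 hu
    exact ⟨k, by rw [← AddCircle.coe_nsmul, nsmul_eq_mul]; congr 1; ring⟩
  have hω : c.natAbs • (((1 / c.natAbs : ℝ)) : UnitAddCircle) = 0 :=
    (AddCircle.nsmul_eq_zero_iff hn).2 <| by
      obtain h | h : c.natAbs = 1 ∨ 1 < c.natAbs := by omega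
      · exact ⟨0, hn, by simp [h, AddCircle.coe_period]⟩
      · exact ⟨1, h, by simp⟩
  obtain ⟨m, hm⟩ := torsion (φ (((1 / c.natAbs : ℝ)) : UnitAddCircle))
    (by rw [← map_nsmul, hω, map_zero])
  refine ⟨m, fun u hu => ?_⟩
  obtain ⟨k, rfl⟩ := torsion u (by
    rcases Int.natAbs_eq c with h | h <;> rw [h] at hu <;> simpa using hu)
  rw [map_nsmul, hm, natCast_zsmul, smul_comm]

/-- The neighborhood filter of `0` in the Bohr topology. -/
def bohrFilter (G : Type*) [AddCommGroup G] : Filter G :=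
  ⨅ χ : G →+ UnitAddCircle, comap χ (𝓝 0)

theorem tendsto_bohrFilter {G : Type*} [AddCommGroup G] (χ : G →+ UnitAddCircle) :
    Tendsto χ (bohrFilter G) (𝓝 0) :=
  tendsto_comap.mono_left (iInf_le _ χ)

theorem containsBohrNhd_iff_mem_bohrFilter {G : Type*} [AddCommGroup G] {S : Set G} :
    ContainsBohrNhd S ↔ S ∈ bohrFilter G := by
  constructor
  · rintro ⟨k, χ, ε, hε, hχ, hS⟩
    have lift : ∀ i, ∃ θ : G →+ UnitAddCircle, ∀ g, (AddCircle.toCircle (θ g) : ℂ) = χ i g := by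
      intro i
      let e := AddCircle.homeomorphCircle (T := (1 : ℝ)) one_ne_zero
      have he : ∀ t, e t = AddCircle.toCircle t := AddCircle.homeomorphCircle_apply one_ne_zero
      let z : G → Circle := fun g => ⟨χ i g, mem_sphere_zero_iff_norm.2 (hχ i g)⟩
      have hz : ∀ g, AddCircle.toCircle (e.symm (z g)) = z g := fun g => by
        rw [← he, e.apply_symm_apply]
      refine ⟨AddMonoidHom.mk' (fun g => e.symm (z g)) fun a b => ?_, fun g => ?_⟩
      · apply AddCircle.injective_toCircle (T := (1 : ℝ)) one_ne_zero
        rw [AddCircle.toCircle_add, hz, hz, hz]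
        exact Subtype.ext (AddChar.map_add_eq_mul (χ i) a b)
      · exact congrArg Subtype.val (hz g)
    choose θ hθ using lift
    have hev : ∀ i, ∀ᶠ g in bohrFilter G, ‖χ i g - 1‖ < ε := by
      intro i
      have hcont : Continuous fun t : UnitAddCircle => ‖(AddCircle.toCircle t : ℂ) - 1‖ :=
        ((continuous_subtype_val.comp AddCircle.continuous_toCircle).sub continuous_const).norm
      have := (hcont.tendsto 0).comp (tendsto_bohrFilter (θ i))
      filter_upwards [this.eventually_lt_const (u := ε) (by simpa using hε)] with g hg
      simpa [hθ] using hg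
    exact mem_of_superset (eventually_all.2 hev) hS
  · intro hS
    obtain ⟨I, hI, V, hV, rfl⟩ := mem_iInf.1 hS
    have := hI.to_subtype
    have key : ∀ i : I, ∀ᶠ ε : ℝ in 𝓝[>] 0,
        ∀ g, ‖(AddCircle.toCircle (i.1 g) : ℂ) - 1‖ < ε → g ∈ V i := by
      intro i
      have hemb : IsEmbedding fun t : UnitAddCircle => (AddCircle.toCircle t : ℂ) := by
        have := (AddCircle.homeomorphCircle (T := (1 : ℝ)) one_ne_zero).isEmbedding
        have := Topology.IsEmbedding.subtypeVal.comp this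
        convert! this using 1
        ext t
        exact congrArg Subtype.val (AddCircle.homeomorphCircle_apply one_ne_zero t).symm
      obtain ⟨W, hW, hWV⟩ := hV i
      rw [hemb.nhds_eq_comap] at hW
      obtain ⟨W', hW', hWW'⟩ := hW
      obtain ⟨δ, hδ, hball⟩ := Metric.mem_nhds_iff.1 hW'
      filter_upwards [Ioo_mem_nhdsGT hδ] with ε hε g hg
      refine hWV (hWW' (hball ?_))
      simpa [dist_eq_norm] using hg.trans hε.2
    obtain ⟨ε, hε, hεpos⟩ := ((eventually_all.2 key).and self_mem_nhdsWithin).exists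
    obtain ⟨k, ⟨e⟩⟩ := Finite.exists_equiv_fin I
    let χ : I → AddChar G ℂ := fun i =>
      { toFun := fun g => AddCircle.toCircle (i.1 g)
        map_zero_eq_one' := by simp
        map_add_eq_mul' := fun a b => by simp [AddCircle.toCircle_add] }
    refine ⟨k, fun j => χ (e.symm j), ε, hεpos, fun i g => Circle.norm_coe _, fun g hg => ?_⟩
    refine Set.mem_iInter.2 fun i => hε i g ?_
    simpa [χ] using hg (e i)

theorem AddSubgroup.mem_bohrFilter_of_index_ne_zero {G : Type*} [AddCommGroup G]
    (H : AddSubgroup G) (hH : H.index ≠ 0) : (H : Set G) ∈ bohrFilter G := by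
  have : H.FiniteIndex := ⟨hH⟩
  refine mem_iff_ultrafilter.2 fun U hU => ?_
  obtain ⟨q, hq⟩ := (U.map (QuotientAddGroup.mk' H)).eq_pure_of_finite
  have hUq : ∀ᶠ g in (U : Filter G), QuotientAddGroup.mk' H g = q := by
    have : {q} ∈ U.map (QuotientAddGroup.mk' H) := by rw [hq]; exact rfl
    exact this
  have hq0 : q = 0 := by
    by_contra hne
    obtain ⟨φ, hφ⟩ := exists_character_ne_zero hne
    have h0 := (tendsto_bohrFilter (φ.comp (QuotientAddGroup.mk' H))).mono_left hU
    refine hφ (tendsto_nhds_unique (tendsto_const_nhds.congr' ?_) h0)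
    filter_upwards [hUq] with g hg
    simp only [AddMonoidHom.comp_apply, hg]
  filter_upwards [hUq] with g hg
  exact (QuotientAddGroup.eq_zero_iff g).1 (hg.trans hq0)

/-- If all characters trivial on the `c`-torsion tend to `0` along an ultrafilter, then the limits
of finitely many characters are simultaneously attained at a `c`-torsion element. -/
theorem exists_torsion_tendsto {G ι : Type*} [AddCommGroup G] [Finite ι] {c : ℤ} (hc : c ≠ 0)
    (U : Ultrafilter G)
    (hU : ∀ ψ : G →+ UnitAddCircle, (∀ g, c • g = 0 → ψ g = 0) → Tendsto ψ U (𝓝 0))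
    (χ : ι → G →+ UnitAddCircle) :
    ∃ h : G, c • h = 0 ∧ ∀ i, Tendsto (χ i) U (𝓝 (χ i h)) := by
  classical
  have := Fintype.ofFinite ι
  have hlim : ∀ i, ∃ z, Tendsto (χ i) U (𝓝 z) := fun i =>
    (isCompact_univ.ultrafilter_le_nhds (U.map (χ i)) (by simp)).imp fun _ hz => hz.2
  choose z hz using hlim
  have hcz : ∀ i, c • z i = 0 := fun i =>
    tendsto_nhds_unique ((hz i).const_smul c)
      (hU (c • χ i) fun g hg => by simp [← map_zsmul, hg])
  have hmem : z ∈ (zsmulAddGroupHom c : G →+ G).ker.map (AddMonoidHom.pi χ) := by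
    by_contra hnot
    obtain ⟨φ, hφ, hφz⟩ := exists_character_ne_zero_of_notMem hnot
    choose m hm using fun i =>
      exists_eq_zsmul_of_zsmul_eq_zero hc (φ.comp (AddMonoidHom.single (fun _ => UnitAddCircle) i))
    have hsum : ∀ u : ι → UnitAddCircle, (∀ i, c • u i = 0) → φ u = ∑ i, m i • u i := by
      intro u hu
      conv_lhs => rw [← Finset.univ_sum_single u, map_sum]
      exact Finset.sum_congr rfl fun i _ => hm i (u i) (hu i)
    have h0 : Tendsto (∑ i, m i • χ i : G →+ UnitAddCircle) U (𝓝 0) := by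
      refine hU _ fun g hg => ?_
      rw [← hφ (AddMonoidHom.pi χ g) ⟨g, hg, rfl⟩, hsum (AddMonoidHom.pi χ g) fun i =>
        (map_zsmul (χ i) c g).symm.trans (by rw [hg, map_zero])]
      simp
    have h1 : Tendsto (∑ i, m i • χ i : G →+ UnitAddCircle) U (𝓝 (φ z)) := by
      rw [hsum z hcz]
      refine (tendsto_finsetSum _ fun i _ => (hz i).const_smul (m i)).congr fun g => ?_
      simp
    exact hφz (tendsto_nhds_unique h1 h0)
  obtain ⟨h, hh, hhz⟩ := hmem
  refine ⟨h, hh, fun i => ?_⟩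
  have : χ i h = z i := congrFun hhz i
  exact this ▸ hz i

theorem eventually_comap_zsmul_bohrFilter {G : Type*} [AddCommGroup G] {c : ℤ} (hc : c ≠ 0)
    {B : Set G} (hB : B ∈ bohrFilter G) :
    ∀ᶠ g in comap (fun g : G => c • g) (bohrFilter G), ∃ h, c • h = 0 ∧ g - h ∈ B := by
  refine mem_iff_ultrafilter.2 fun U hU => ?_
  obtain ⟨t, ht⟩ := (mem_iInf_finite B).1 hB
  obtain ⟨h, hh, hlim⟩ := exists_torsion_tendsto hc U (fun χ hχ => by
    obtain ⟨ψ, hψ⟩ := exists_character_comp_eq (zsmulAddGroupHom c) χ hχ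
    have h0 := (tendsto_bohrFilter ψ).comp (tendsto_comap.mono_left hU)
    exact h0.congr hψ) (fun i : t => i.1)
  have hsub : Tendsto (fun g => g - h) U (⨅ χ ∈ t, comap χ (𝓝 0)) := by
    refine tendsto_iInf.2 fun χ => tendsto_iInf.2 fun hχ => tendsto_comap_iff.2 ?_
    have := (hlim ⟨χ, hχ⟩).sub_const (χ h)
    rw [sub_self] at this
    exact this.congr fun g => (map_sub χ g h).symm
  filter_upwards [hsub ht] with g hg
  exact ⟨h, hh, hg⟩

theorem stmt2 {G : Type*} [AddCommGroup G] (B : Set G) (hB : ContainsBohrNhd B)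
    (c : ℤ) (hc : (multiplesSubgroup G c).index ≠ 0) :
    ContainsBohrNhd ((fun b => c • b) '' B) := by
  rw [containsBohrNhd_iff_mem_bohrFilter] at hB ⊢
  have hrange := (multiplesSubgroup G c).mem_bohrFilter_of_index_ne_zero hc
  obtain rfl | hc0 := eq_or_ne c 0
  · have h0 : (0 : G) ∈ B := by
      obtain ⟨k, χ, ε, hε, -, hS⟩ := containsBohrNhd_iff_mem_bohrFilter.2 hB
      exact hS 0 fun i => by simpa using hε
    filter_upwards [hrange] with x hx
    obtain ⟨g, rfl⟩ := hx
    exact ⟨0, h0, by simp⟩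
  · filter_upwards [hrange, eventually_comap.1 (eventually_comap_zsmul_bohrFilter hc0 hB)]
      with x hx hxB
    obtain ⟨g, rfl⟩ := hx
    obtain ⟨h, hh, hgh⟩ := hxB g rfl
    exact ⟨g - h, hgh, by simp [smul_sub, hh]⟩
end

section
/- Let G be a countable abelian group. For every subset A ⊆ G, there exists an invariant mean m on ℓ^∞(G) which is an extreme point of the (weak* compact convex) set of invariant means, such that m(1_A) = d*(A), the upper Banach density of A. -/
open Filter BoundedContinuousFunction
open scoped Classical

section Defs

variable (G : Type*) [AddCommGroup G] [TopologicalSpace G] [DiscreteTopology G] [DecidableEq G]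

/-- `F` is a Følner sequence in `G`. -/
def IsFolner (F : ℕ → Finset G) : Prop :=
  (∀ n, (F n).Nonempty) ∧ ∀ g : G,
    Tendsto (fun n => ((symmDiff (F n) ((F n).image (g + ·))).card : ℝ) / (F n).card)
      atTop (nhds 0)

/-- Upper Banach density: the sup over Følner sequences of the upper density along them. -/
noncomputable def upperBanachDensity (A : Set G) : ℝ :=
  sSup { x | ∃ F : ℕ → Finset G, IsFolner G F ∧
    x = limsup (fun n => (((F n).filter (fun g => g ∈ A)).card : ℝ) / (F n).card) atTop }

/-- The translate `φ_t` of `φ ∈ ℓ^∞(G)`, `φ_t (g) = φ (g + t)`. -/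
def translateBCF (φ : G →ᵇ ℝ) (t : G) : G →ᵇ ℝ :=
  φ.compContinuous ⟨fun g => g + t, continuous_of_discreteTopology⟩

/-- An invariant mean on `ℓ^∞(G)`: a positive unital translation-invariant linear functional. -/
def IsInvariantMean (m : (G →ᵇ ℝ) →ₗ[ℝ] ℝ) : Prop :=
  (∀ φ : G →ᵇ ℝ, (∀ g, 0 ≤ φ g) → 0 ≤ m φ) ∧ m 1 = 1 ∧
    ∀ (φ : G →ᵇ ℝ) (t : G), m (translateBCF G φ t) = m φ

/-- The indicator function of `A ⊆ G` as a bounded (continuous) function on discrete `G`. -/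
noncomputable def indicatorBCF (A : Set G) : G →ᵇ ℝ :=
  BoundedContinuousFunction.ofNormedAddCommGroup
    (fun g => if g ∈ A then (1 : ℝ) else 0) continuous_of_discreteTopology 1
    (by intro g; dsimp; split <;> simp)

end Defs

section Folner

variable {G : Type*} [AddCommGroup G] [DecidableEq G]

/-- The set of sums `∑ s ∈ S, f s • s` with coefficients `f s ≤ k`. -/
def coeffBox (S : Finset G) (k : ℕ) : Finset G :=
  (Fintype.piFinset fun _ : S => Finset.range (k + 1)).image fun f => ∑ s : S, f s • (s : G)

lemma mem_coeffBox {S : Finset G} {k : ℕ} {x : G} :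
    x ∈ coeffBox S k ↔ ∃ f : S → ℕ, (∀ s, f s ≤ k) ∧ ∑ s : S, f s • (s : G) = x := by
  simp [coeffBox]

lemma coeffBox_nonempty (S : Finset G) (k : ℕ) : (coeffBox S k).Nonempty :=
  ⟨0, mem_coeffBox.2 ⟨0, by simp, by simp⟩⟩

lemma card_coeffBox_le (S : Finset G) (k : ℕ) : (coeffBox S k).card ≤ (k + 1) ^ S.card := by
  refine Finset.card_image_le.trans ?_
  simp [Fintype.card_piFinset]

lemma coeffBox_subset_succ (S : Finset G) (k : ℕ) : coeffBox S k ⊆ coeffBox S (k + 1) := by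
  intro x hx
  obtain ⟨f, hf, rfl⟩ := mem_coeffBox.1 hx
  exact mem_coeffBox.2 ⟨f, fun s => (hf s).trans k.le_succ, rfl⟩

lemma image_add_coeffBox_subset {S : Finset G} {g : G} (hg : g ∈ S) (k : ℕ) :
    (coeffBox S k).image (g + ·) ⊆ coeffBox S (k + 1) := by
  intro x hx
  obtain ⟨y, hy, rfl⟩ := Finset.mem_image.1 hx
  obtain ⟨f, hf, rfl⟩ := mem_coeffBox.1 hy
  refine mem_coeffBox.2 ⟨f + Pi.single ⟨g, hg⟩ 1, fun s => ?_, ?_⟩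
  · have h : (Pi.single (⟨g, hg⟩ : S) 1 : S → ℕ) s ≤ 1 := by
      by_cases h : s = ⟨g, hg⟩
      · subst h; simp
      · simp [h]
    exact add_le_add (hf s) h
  · simp only [Pi.add_apply, add_smul, Finset.sum_add_distrib]
    rw [add_comm, Finset.sum_eq_single (⟨g, hg⟩ : S)]
    · simp
    · intro b _ hb
      simp [hb]
    · simp

lemma exists_card_coeffBox_succ_le (S : Finset G) {ε : ℝ} (hε : 0 < ε) :
    ∃ k, ((coeffBox S (k + 1)).card : ℝ) ≤ (1 + ε) * (coeffBox S k).card := by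
  by_contra! h
  have hpow : ∀ k : ℕ, (1 + ε) ^ k ≤ ((coeffBox S k).card : ℝ) := by
    intro k
    induction k with
    | zero =>
      simpa [Nat.one_le_iff_ne_zero] using (coeffBox_nonempty S 0).card_pos.ne'
    | succ k ih =>
      rw [pow_succ']
      exact (mul_le_mul_of_nonneg_left ih (by positivity)).trans (h k).le
  have hlim := (tendsto_pow_const_div_const_pow_of_one_lt S.card
    (show 1 < 1 + ε by linarith)).comp (tendsto_add_atTop_nat 1)
  obtain ⟨k, hk⟩ := (hlim.eventually_lt_const
    (show (0 : ℝ) < 1 / (1 + ε) by positivity)).exists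
  have hcard : ((coeffBox S k).card : ℝ) ≤ ((k : ℝ) + 1) ^ S.card := by
    exact_mod_cast card_coeffBox_le S k
  simp only [Function.comp_apply, Nat.cast_add, Nat.cast_one] at hk
  rw [div_lt_div_iff₀ (by positivity) (by positivity), pow_succ] at hk
  have := (hpow k).trans hcard
  nlinarith

lemma exists_almost_invariant (S : Finset G) {ε : ℝ} (hε : 0 < ε) :
    ∃ F : Finset G, F.Nonempty ∧ ∀ g ∈ S,
      ((symmDiff F (F.image (g + ·))).card : ℝ) / F.card ≤ ε := by
  obtain ⟨k, hk⟩ := exists_card_coeffBox_succ_le S (half_pos hε)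
  refine ⟨coeffBox S k, coeffBox_nonempty S k, fun g hg => ?_⟩
  have hpos : (0 : ℝ) < (coeffBox S k).card := by exact_mod_cast (coeffBox_nonempty S k).card_pos
  rw [div_le_iff₀ hpos]
  have hcard : ((coeffBox S k).image (g + ·)).card = (coeffBox S k).card :=
    Finset.card_image_of_injective _ (add_right_injective g)
  have h₁ : (coeffBox S (k + 1) \ coeffBox S k).card + (coeffBox S k).card
      = (coeffBox S (k + 1)).card :=
    Finset.card_sdiff_add_card_eq_card (coeffBox_subset_succ S k)
  have h₂ : (coeffBox S (k + 1) \ (coeffBox S k).image (g + ·)).card + (coeffBox S k).card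
      = (coeffBox S (k + 1)).card := by
    rw [← Finset.card_sdiff_add_card_eq_card (image_add_coeffBox_subset hg k), hcard]
  have h₃ : (symmDiff (coeffBox S k) ((coeffBox S k).image (g + ·))).card ≤
      (coeffBox S (k + 1) \ (coeffBox S k).image (g + ·)).card +
        (coeffBox S (k + 1) \ coeffBox S k).card := by
    refine (Finset.card_union_le _ _).trans (add_le_add ?_ ?_)
    · exact Finset.card_le_card (Finset.sdiff_subset_sdiff (coeffBox_subset_succ S k) le_rfl)
    · exact Finset.card_le_card
        (Finset.sdiff_subset_sdiff (image_add_coeffBox_subset hg k) le_rfl)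
  have h₁' : ((coeffBox S (k + 1) \ coeffBox S k).card : ℝ) + (coeffBox S k).card
      = (coeffBox S (k + 1)).card := by exact_mod_cast h₁
  have h₂' : ((coeffBox S (k + 1) \ (coeffBox S k).image (g + ·)).card : ℝ) + (coeffBox S k).card
      = (coeffBox S (k + 1)).card := by exact_mod_cast h₂
  have h₃' : ((symmDiff (coeffBox S k) ((coeffBox S k).image (g + ·))).card : ℝ) ≤
      (coeffBox S (k + 1) \ (coeffBox S k).image (g + ·)).card +
        (coeffBox S (k + 1) \ coeffBox S k).card := by exact_mod_cast h₃
  linarith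

variable (G) in
lemma exists_isFolner [Countable G] : ∃ F : ℕ → Finset G, IsFolner G F := by
  obtain ⟨e, he⟩ := exists_surjective_nat G
  choose F hne hF using fun n : ℕ => exists_almost_invariant
    ((Finset.range (n + 1)).image e) (Nat.one_div_pos_of_nat (α := ℝ) (n := n))
  refine ⟨F, hne, fun g => ?_⟩
  obtain ⟨i, rfl⟩ := he g
  refine squeeze_zero' (Eventually.of_forall fun n => by positivity) ?_
    tendsto_one_div_add_atTop_nhds_zero_nat
  filter_upwards [eventually_ge_atTop i] with n hn
  exact hF n _ (Finset.mem_image_of_mem e (Finset.mem_range.2 (by omega)))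

lemma IsFolner.translate {F : ℕ → Finset G} (hF : IsFolner G F) (x : ℕ → G) :
    IsFolner G fun n => (F n).image (x n + ·) := by
  refine ⟨fun n => (hF.1 n).image _, fun g => (hF.2 g).congr fun n => ?_⟩
  have hinj := add_right_injective (x n)
  have h : ((F n).image (x n + ·)).image (g + ·) = ((F n).image (g + ·)).image (x n + ·) := by
    simp only [Finset.image_image]
    congr 1
    ext y
    simp [add_left_comm]
  rw [h, ← Finset.image_symmDiff _ _ hinj, Finset.card_image_of_injective _ hinj,
    Finset.card_image_of_injective _ hinj]

end Folner

section Averages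

variable {G : Type*} [TopologicalSpace G]

/-- The average of a bounded function over a finite set. -/
noncomputable def finAvg (F : Finset G) (φ : G →ᵇ ℝ) : ℝ := (∑ g ∈ F, φ g) / F.card

lemma abs_finAvg_le (F : Finset G) (φ : G →ᵇ ℝ) : |finAvg F φ| ≤ ‖φ‖ := by
  rw [finAvg, abs_div, Nat.abs_cast]
  refine div_le_of_le_mul₀ (by positivity) (norm_nonneg _) ?_
  refine (Finset.abs_sum_le_sum_abs _ _).trans ?_
  refine (Finset.sum_le_card_nsmul _ _ ‖φ‖ fun g _ => φ.norm_coe_le_norm g).trans ?_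
  rw [nsmul_eq_mul, mul_comm]

variable [DiscreteTopology G]

lemma indicatorBCF_apply (A : Set G) (g : G) :
    indicatorBCF G A g = if g ∈ A then (1 : ℝ) else 0 := rfl

lemma finAvg_indicatorBCF (F : Finset G) (A : Set G) :
    finAvg F (indicatorBCF G A) = ((F.filter (fun g => g ∈ A)).card : ℝ) / F.card := by
  simp [finAvg, indicatorBCF_apply]

end Averages

section Means

variable {G : Type*} [AddCommGroup G] [TopologicalSpace G] [DiscreteTopology G]

lemma translateBCF_apply (φ : G →ᵇ ℝ) (t g : G) : translateBCF G φ t g = φ (g + t) := rfl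

lemma abs_finAvg_translateBCF_sub_le [DecidableEq G] (F : Finset G) (φ : G →ᵇ ℝ) (t : G) :
    |finAvg F (translateBCF G φ t) - finAvg F φ| ≤
      ‖φ‖ * (((symmDiff F (F.image (t + ·))).card : ℝ) / F.card) := by
  have h : ∑ g ∈ F, translateBCF G φ t g = ∑ g ∈ F.image (t + ·), φ g := by
    rw [Finset.sum_image (add_right_injective t).injOn]
    simp [translateBCF_apply, add_comm]
  have hb (s : Finset G) : |∑ g ∈ s, φ g| ≤ s.card * ‖φ‖ := by
    refine (Finset.abs_sum_le_sum_abs _ _).trans ?_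
    refine (Finset.sum_le_card_nsmul _ _ ‖φ‖ fun g _ => φ.norm_coe_le_norm g).trans ?_
    rw [nsmul_eq_mul]
  have hc : (symmDiff F (F.image (t + ·))).card =
      (F \ F.image (t + ·)).card + (F.image (t + ·) \ F).card :=
    Finset.card_union_of_disjoint disjoint_sdiff_sdiff
  rw [finAvg, finAvg, ← sub_div, h, abs_div, Nat.abs_cast, mul_div_assoc']
  gcongr
  rw [← Finset.sum_sdiff_sub_sum_sdiff, hc]
  refine (abs_sub _ _).trans ?_
  push_cast
  linarith [hb (F \ F.image (t + ·)), hb (F.image (t + ·) \ F)]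

/-- The limit of averages along a Følner sequence and an ultrafilter is an invariant mean. -/
lemma IsFolner.exists_mean [DecidableEq G] {F : ℕ → Finset G} (hF : IsFolner G F)
    (U : Ultrafilter ℕ) (hU : (U : Filter ℕ) ≤ atTop) :
    ∃ m : (G →ᵇ ℝ) →ₗ[ℝ] ℝ, IsInvariantMean G m ∧
      ∀ φ, Tendsto (fun n => finAvg (F n) φ) U (nhds (m φ)) := by
  have hlim (φ : G →ᵇ ℝ) : ∃ x, Tendsto (fun n => finAvg (F n) φ) U (nhds x) := by
    obtain ⟨x, -, hx⟩ := (isCompact_Icc (a := -‖φ‖) (b := ‖φ‖)).ultrafilter_le_nhds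
      (U.map fun n => finAvg (F n) φ)
      (tendsto_principal.2 (Eventually.of_forall fun n => abs_le.1 (abs_finAvg_le (F n) φ)))
    exact ⟨x, hx⟩
  choose m hm using hlim
  refine ⟨⟨⟨m, fun φ ψ => ?_⟩, fun c φ => ?_⟩, ⟨fun φ hφ => ?_, ?_, fun φ t => ?_⟩, hm⟩
  · refine tendsto_nhds_unique (hm (φ + ψ)) (((hm φ).add (hm ψ)).congr fun n => ?_)
    simp [finAvg, Finset.sum_add_distrib, add_div]
  · refine tendsto_nhds_unique (hm (c • φ)) (((hm φ).const_mul c).congr fun n => ?_)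
    simp [finAvg, ← Finset.mul_sum, mul_div_assoc]
  · exact ge_of_tendsto' (hm φ) fun n =>
      div_nonneg (Finset.sum_nonneg fun g _ => hφ g) (Nat.cast_nonneg _)
  · refine tendsto_nhds_unique (hm 1) (tendsto_const_nhds.congr fun n => ?_)
    have : ((F n).card : ℝ) ≠ 0 := by exact_mod_cast (hF.1 n).card_pos.ne'
    simp [finAvg, this]
  · refine tendsto_nhds_unique (hm (translateBCF G φ t)) ?_
    have h0 : Tendsto (fun n => finAvg (F n) (translateBCF G φ t) - finAvg (F n) φ) U
        (nhds 0) := by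
      refine squeeze_zero_norm (fun n => abs_finAvg_translateBCF_sub_le (F n) φ t) ?_
      simpa using ((hF.2 t).mono_left hU).const_mul ‖φ‖
    simpa using h0.add (hm φ)

lemma IsInvariantMean.mono {m : (G →ᵇ ℝ) →ₗ[ℝ] ℝ} (hm : IsInvariantMean G m) {φ ψ : G →ᵇ ℝ}
    (h : ∀ g, φ g ≤ ψ g) : m φ ≤ m ψ := by
  have := hm.1 (ψ - φ) fun g => by simpa using h g
  rw [map_sub] at this
  linarith

lemma IsInvariantMean.le_of_forall_le {m : (G →ᵇ ℝ) →ₗ[ℝ] ℝ} (hm : IsInvariantMean G m)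
    {φ : G →ᵇ ℝ} {c : ℝ} (h : ∀ g, φ g ≤ c) : m φ ≤ c := by
  have := hm.mono (ψ := c • 1) fun g => by simpa using h g
  simpa [hm.2.1] using this

lemma IsInvariantMean.abs_le_norm {m : (G →ᵇ ℝ) →ₗ[ℝ] ℝ} (hm : IsInvariantMean G m)
    (φ : G →ᵇ ℝ) : |m φ| ≤ ‖φ‖ := by
  refine abs_le'.2 ⟨hm.le_of_forall_le fun g => (le_abs_self _).trans (φ.norm_coe_le_norm g), ?_⟩
  rw [← map_neg]
  exact hm.le_of_forall_le fun g => (neg_le_abs (φ g)).trans (φ.norm_coe_le_norm g)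

/-- Some translate of a finite set sees a density at least that given by an invariant mean. -/
lemma IsInvariantMean.exists_lt_finAvg [DecidableEq G] {m : (G →ᵇ ℝ) →ₗ[ℝ] ℝ}
    (hm : IsInvariantMean G m) {F : Finset G} (hF : F.Nonempty) (φ : G →ᵇ ℝ) {c : ℝ}
    (hc : c < m φ) : ∃ x, c < finAvg (F.image (x + ·)) φ := by
  by_contra! h
  have hne : (F.card : ℝ) ≠ 0 := by exact_mod_cast hF.card_pos.ne'
  have hle : m ((F.card : ℝ)⁻¹ • ∑ t ∈ F, translateBCF G φ t) ≤ c := by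
    refine hm.le_of_forall_le fun x => ?_
    refine le_of_eq_of_le ?_ (h x)
    rw [finAvg, Finset.sum_image (add_right_injective x).injOn,
      Finset.card_image_of_injective _ (add_right_injective x), div_eq_inv_mul]
    simp [translateBCF_apply, BoundedContinuousFunction.sum_apply]
  rw [map_smul, map_sum, Finset.sum_congr rfl fun t _ => hm.2.2 φ t, Finset.sum_const,
    nsmul_eq_mul, smul_eq_mul, inv_mul_cancel_left₀ hne] at hle
  exact hc.not_ge hle

variable (G) in
/-- The invariant means, as a subset of a product of copies of `ℝ`. -/
def meanSet : Set ((G →ᵇ ℝ) → ℝ) := {f | ∃ m, IsInvariantMean G m ∧ ⇑m = f}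

lemma meanSet_eq : meanSet G = {f | (∀ φ ψ, f (φ + ψ) = f φ + f ψ) ∧
    (∀ (c : ℝ) φ, f (c • φ) = c * f φ) ∧ (∀ φ : G →ᵇ ℝ, (∀ g, 0 ≤ φ g) → 0 ≤ f φ) ∧
    f 1 = 1 ∧ ∀ φ t, f (translateBCF G φ t) = f φ} := by
  ext f
  constructor
  · rintro ⟨m, hm, rfl⟩
    exact ⟨map_add m, map_smul m, hm⟩
  · rintro ⟨hadd, hsmul, h⟩
    exact ⟨⟨⟨f, hadd⟩, hsmul⟩, h, rfl⟩

lemma isClosed_meanSet : IsClosed (meanSet G) := by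
  rw [meanSet_eq]
  simp only [Set.ofPred_and, Set.ofPred_forall]
  refine .inter ?_ (.inter ?_ (.inter ?_ (.inter ?_ ?_)))
  · exact isClosed_iInter fun φ => isClosed_iInter fun ψ => isClosed_eq (by fun_prop) (by fun_prop)
  · exact isClosed_iInter fun c => isClosed_iInter fun φ => isClosed_eq (by fun_prop) (by fun_prop)
  · exact isClosed_iInter fun φ => isClosed_iInter fun _ => isClosed_le (by fun_prop) (by fun_prop)
  · exact isClosed_eq (by fun_prop) (by fun_prop)
  · exact isClosed_iInter fun φ => isClosed_iInter fun t => isClosed_eq (by fun_prop) (by fun_prop)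

lemma isCompact_meanSet : IsCompact (meanSet G) := by
  refine (isCompact_univ_pi fun φ : G →ᵇ ℝ =>
    isCompact_Icc (a := -‖φ‖) (b := ‖φ‖)).of_isClosed_subset
      isClosed_meanSet ?_
  rintro _ ⟨m, hm, rfl⟩ φ -
  exact abs_le.1 (hm.abs_le_norm φ)

lemma exists_extreme_mean_maximizing (hne : (meanSet G).Nonempty) (φ : G →ᵇ ℝ) :
    ∃ f ∈ (meanSet G).extremePoints ℝ, ∀ g ∈ meanSet G, g φ ≤ f φ := by
  let l : StrongDual ℝ ((G →ᵇ ℝ) → ℝ) := ContinuousLinearMap.proj φ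
  have hexp : IsExposed ℝ (meanSet G) (l.toExposed (meanSet G)) :=
    ContinuousLinearMap.toExposed.isExposed
  obtain ⟨f₀, hf₀, hmax⟩ := isCompact_meanSet.exists_isMaxOn hne l.continuous.continuousOn
  obtain ⟨f, hf⟩ := (hexp.isCompact isCompact_meanSet).extremePoints_nonempty ⟨f₀, hf₀, hmax⟩
  exact ⟨f, hexp.isExtreme.extremePoints_subset_extremePoints hf, hf.1.2⟩

end Means

section Density

variable {G : Type*} [AddCommGroup G] [TopologicalSpace G] [DiscreteTopology G] [DecidableEq G]

/-- A bound for the value of every invariant mean bounds the upper density along every Følner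
sequence. -/
lemma IsFolner.limsup_le {F : ℕ → Finset G} (hF : IsFolner G F) (φ : G →ᵇ ℝ) {M : ℝ}
    (hM : ∀ m, IsInvariantMean G m → m φ ≤ M) :
    limsup (fun n => finAvg (F n) φ) atTop ≤ M := by
  by_contra! h
  obtain ⟨c, hMc, hc⟩ := exists_between h
  have hbdd : IsBoundedUnder (· ≥ ·) atTop fun n => finAvg (F n) φ :=
    isBoundedUnder_of ⟨-‖φ‖, fun n => (abs_le.1 (abs_finAvg_le (F n) φ)).1⟩
  have hfreq := frequently_lt_of_lt_limsup hbdd.isCoboundedUnder_le hc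
  have : NeBot (atTop ⊓ 𝓟 {n | c < finAvg (F n) φ}) := frequently_mem_iff_neBot.1 hfreq
  let U := Ultrafilter.of (atTop ⊓ 𝓟 {n | c < finAvg (F n) φ})
  have hU : (U : Filter ℕ) ≤ atTop ⊓ 𝓟 {n | c < finAvg (F n) φ} := Ultrafilter.of_le _
  obtain ⟨m, hm, hlim⟩ := hF.exists_mean U (hU.trans inf_le_left)
  have hev : ∀ᶠ n in (U : Filter ℕ), c < finAvg (F n) φ :=
    le_principal_iff.1 (hU.trans inf_le_right)
  have hcm : c ≤ m φ := ge_of_tendsto (hlim φ) (hev.mono fun _ => le_of_lt)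
  linarith [hM m hm]

lemma IsInvariantMean.exists_isFolner_le_limsup [Countable G] {m : (G →ᵇ ℝ) →ₗ[ℝ] ℝ}
    (hm : IsInvariantMean G m) (φ : G →ᵇ ℝ) :
    ∃ F : ℕ → Finset G, IsFolner G F ∧ m φ ≤ limsup (fun n => finAvg (F n) φ) atTop := by
  obtain ⟨F, hF⟩ := exists_isFolner G
  choose x hx using fun n : ℕ => hm.exists_lt_finAvg (hF.1 n) φ
    (sub_lt_self (m φ) (Nat.one_div_pos_of_nat (α := ℝ) (n := n)))
  refine ⟨_, hF.translate x, ?_⟩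
  have hlim : Tendsto (fun n : ℕ => m φ - 1 / ((n : ℝ) + 1)) atTop (nhds (m φ)) := by
    simpa using tendsto_const_nhds.sub (tendsto_one_div_add_atTop_nhds_zero_nat (𝕜 := ℝ))
  rw [← hlim.limsup_eq]
  exact limsup_le_limsup (Eventually.of_forall fun n => (hx n).le)
    hlim.isBoundedUnder_ge.isCoboundedUnder_le
    (isBoundedUnder_of ⟨‖φ‖, fun n => (abs_le.1 (abs_finAvg_le _ φ)).2⟩)

lemma upperBanachDensity_eq_of_isMax [Countable G] {A : Set G} {m : (G →ᵇ ℝ) →ₗ[ℝ] ℝ}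
    (hm : IsInvariantMean G m)
    (hmax : ∀ m', IsInvariantMean G m' → m' (indicatorBCF G A) ≤ m (indicatorBCF G A)) :
    m (indicatorBCF G A) = upperBanachDensity G A := by
  have hub : ∀ x ∈ { x | ∃ F : ℕ → Finset G, IsFolner G F ∧
      x = limsup (fun n => (((F n).filter (fun g => g ∈ A)).card : ℝ) / (F n).card) atTop },
      x ≤ m (indicatorBCF G A) := by
    rintro _ ⟨F, hF, rfl⟩
    simpa only [finAvg_indicatorBCF] using hF.limsup_le _ hmax
  obtain ⟨F, hF, hle⟩ := hm.exists_isFolner_le_limsup (indicatorBCF G A)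
  simp only [finAvg_indicatorBCF] at hle
  exact le_antisymm (hle.trans (le_csSup ⟨_, hub⟩ ⟨F, hF, rfl⟩)) (csSup_le ⟨_, F, hF, rfl⟩ hub)

end Density

theorem stmt6 {G : Type*} [AddCommGroup G] [TopologicalSpace G] [DiscreteTopology G]
    [Countable G] [DecidableEq G] (A : Set G) :
    ∃ m : (G →ᵇ ℝ) →ₗ[ℝ] ℝ, IsInvariantMean G m ∧
      (∀ (m₁ m₂ : (G →ᵇ ℝ) →ₗ[ℝ] ℝ) (θ : ℝ), IsInvariantMean G m₁ → IsInvariantMean G m₂ →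
        0 < θ → θ < 1 → m = θ • m₁ + (1 - θ) • m₂ → m₁ = m₂) ∧
      m (indicatorBCF G A) = upperBanachDensity G A := by
  obtain ⟨F, hF⟩ := exists_isFolner G
  obtain ⟨m₀, hm₀, -⟩ := hF.exists_mean (Ultrafilter.of atTop) (Ultrafilter.of_le _)
  obtain ⟨_, ⟨⟨m, hm, rfl⟩, hext⟩, hmax⟩ :=
    exists_extreme_mean_maximizing ⟨_, m₀, hm₀, rfl⟩ (indicatorBCF G A)
  refine ⟨m, hm, fun m₁ m₂ θ h₁ h₂ hθ hθ' h => ?_,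
    upperBanachDensity_eq_of_isMax hm fun m' hm' => hmax _ ⟨m', hm', rfl⟩⟩
  have hseg : ⇑m ∈ openSegment ℝ ⇑m₁ ⇑m₂ :=
    ⟨θ, 1 - θ, hθ, by linarith, by ring, by rw [h]; rfl⟩
  have hseg' : ⇑m ∈ openSegment ℝ ⇑m₂ ⇑m₁ := openSegment_symm ℝ ⇑m₁ ⇑m₂ ▸ hseg
  exact DFunLike.coe_injective
    ((hext ⟨m₁, h₁, rfl⟩ ⟨m₂, h₂, rfl⟩ hseg).trans (hext ⟨m₂, h₂, rfl⟩ ⟨m₁, h₁, rfl⟩ hseg').symm)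
end
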